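/- arXiv:1802.07153 — 3 statements merged into one kernel-verified Lean document; each statement's English description precedes it below -/
import Mathlib

section
/- Let W be a finite-dimensional complex vector space and k ≥ 1 an integer. Let V be a linear subspace of W^k such that for every integer i ≥ 1, every alternating i-linear form α on W, and all vectors v^1, …, v^i ∈ V, one has ∑_{j=1}^{k} α(pr_j(v^1), …, pr_j(v^i)) = 0, where pr_j : W^k → W is the projection onto the j-th factor. Then dim V ≤ k − 1. -/
open Module

/-- The span in `ℂ^ι` of the functions `j ↦ α (v 0 j, …, v (i - 1) j)`, where `α` is an alternating
form of any degree `i ≥ 0` and the `v l` lie in `V`. -/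
def alternatingValues {ι W : Type*} [AddCommGroup W] [Module ℂ W]
    (V : Submodule ℂ (ι → W)) : Submodule ℂ (ι → ℂ) :=
  Submodule.span ℂ {f | ∃ (i : ℕ) (α : W [⋀^Fin i]→ₗ[ℂ] ℂ) (v : Fin i → ι → W),
    (∀ l, v l ∈ V) ∧ f = fun j => α fun l => v l j}

section ScherkKemperman

variable {ι : Type*}

lemma aeval_mem_of_mul_mem {X : Submodule ℂ (ι → ℂ)} (h1 : 1 ∈ X) {n : ι → ℂ}
    (hn : ∀ x ∈ X, x * n ∈ X) (p : Polynomial ℂ) : Polynomial.aeval n p ∈ X := by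
  have hpow (m : ℕ) : n ^ m ∈ X := by
    induction m with
    | zero => simpa using h1
    | succ m ih => simpa [pow_succ] using hn _ ih
  rw [Polynomial.aeval_eq_sum_range]
  exact Submodule.sum_mem _ fun i _ => X.smul_mem _ (hpow i)

variable [Fintype ι]

lemma exists_eval_eq_star (n : ι → ℂ) :
    ∃ p : Polynomial ℂ, Polynomial.aeval n p = star n := by
  classical
  refine ⟨Lagrange.interpolate (Finset.univ.image n) id star, ?_⟩
  ext j
  have h := Lagrange.eval_interpolate_at_node (s := Finset.univ.image n) (v := id)
    (star : ℂ → ℂ) Function.injective_id.injOn (Finset.mem_image_of_mem n (Finset.mem_univ j))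
  rw [Polynomial.aeval_pi_apply₂, Polynomial.coe_aeval_eq_eval]
  simpa using h

lemma exists_unit_mul_notMem {X : Submodule ℂ (ι → ℂ)} (h1 : 1 ∈ X) {x y : ι → ℂ} (hx : x ∈ X)
    (hxy : x * y ∉ X) : ∃ a ∈ X, IsUnit a ∧ a * y ∉ X := by
  classical
  by_cases hy : y ∈ X
  · obtain ⟨c, hc⟩ := Infinite.exists_notMem_finset (Finset.univ.image x)
    refine ⟨x - c • 1, X.sub_mem hx (X.smul_mem _ h1), ?_, fun h => hxy ?_⟩
    · rw [Pi.isUnit_iff]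
      intro j
      rw [isUnit_iff_ne_zero]
      intro h
      apply hc
      simp only [Pi.sub_apply, Pi.smul_apply, Pi.one_apply, smul_eq_mul, mul_one] at h
      simpa using ⟨j, sub_eq_zero.mp h⟩
    · have := X.add_mem h (X.smul_mem c hy)
      simpa [sub_mul] using this
  · exact ⟨1, h1, isUnit_one, by simpa using hy⟩

/-- A linear analogue of the Scherk–Kemperman theorem. -/
lemma finrank_add_finrank_le_finrank_mul_add_one (τ : (ι → ℂ) →ₗ[ℂ] ℂ) (hτ1 : τ 1 = 1)
    (hτ : ∀ n, τ (star n * n) = 0 → n = 0) (X Y : Submodule ℂ (ι → ℂ)) (hX : 1 ∈ X) (hY : 1 ∈ Y)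
    (hXY : ∀ x ∈ X, ∀ y ∈ Y, τ (x * y) = τ x * τ y) :
    finrank ℂ X + finrank ℂ Y ≤ finrank ℂ ↥(X * Y) + 1 := by
  induction hd : finrank ℂ Y using Nat.strong_induction_on generalizing X Y with
  | _ d ih =>
  subst hd
  by_cases hstab : ∀ x ∈ X, ∀ y ∈ Y, x * y ∈ X
  · have hle : Y ≤ Submodule.span ℂ {1} := by
      intro y hy
      have hn : y - τ y • 1 ∈ Y := Y.sub_mem hy (Y.smul_mem _ hY)
      obtain ⟨p, hp⟩ := exists_eval_eq_star (y - τ y • 1)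
      have hp' := aeval_mem_of_mul_mem hX (fun x hx => hstab x hx _ hn) p
      have := hτ (y - τ y • 1) (by rw [← hp, hXY _ hp' _ hn]; simp [hτ1])
      exact Submodule.mem_span_singleton.mpr ⟨τ y, (sub_eq_zero.mp this).symm⟩
    have hY1 : finrank ℂ Y ≤ 1 :=
      (Submodule.finrank_mono hle).trans (by simpa using finrank_span_le_card ({1} : Set (ι → ℂ)))
    have hXX : finrank ℂ X ≤ finrank ℂ ↥(X * Y) := Submodule.finrank_mono fun x hx => by
      simpa using Submodule.mul_mem_mul hx hY
    omega
  · push Not at hstab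
    obtain ⟨x, hx, y, hy, hxy⟩ := hstab
    obtain ⟨a, ha, hau, hay⟩ := exists_unit_mul_notMem hX hx hxy
    let m : (ι → ℂ) →ₗ[ℂ] (ι → ℂ) := LinearMap.mulLeft ℂ a
    have hm : Function.Injective m := fun u v h => hau.mul_left_cancel h
    have hlt : Y ⊓ X.comap m < Y :=
      lt_of_le_of_ne inf_le_left fun h => hay (by
        rw [← h] at hy
        exact hy.2)
    have hmem : X ⊓ Y.map m = (Y ⊓ X.comap m).map m := by
      ext z
      constructor
      · rintro ⟨hz, u, hu, rfl⟩
        exact ⟨u, ⟨hu, hz⟩, rfl⟩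
      · rintro ⟨u, ⟨hu, hz⟩, rfl⟩
        exact ⟨hz, u, hu, rfl⟩
    have hdim := Submodule.finrank_sup_add_finrank_inf_eq X (Y.map m)
    rw [hmem, ← (Submodule.equivMapOfInjective m hm _).finrank_eq,
      ← (Submodule.equivMapOfInjective m hm _).finrank_eq] at hdim
    have hprod : (X ⊔ Y.map m) * (Y ⊓ X.comap m) ≤ X * Y := by
      rw [Submodule.sup_mul, sup_le_iff]
      refine ⟨mul_le_mul_right inf_le_left _, Submodule.mul_le.mpr ?_⟩
      rintro _ ⟨u, hu, rfl⟩ v ⟨-, hv⟩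
      have : m u * v = m v * u := by simp only [m, LinearMap.mulLeft_apply]; ring
      rw [this]
      exact Submodule.mul_mem_mul hv hu
    have key := ih _ (Submodule.finrank_lt_finrank_of_lt hlt) (X ⊔ Y.map m) (Y ⊓ X.comap m)
      (Submodule.mem_sup_left hX) ⟨hY, by simpa [m] using ha⟩ (by
        intro z hz v hv
        obtain ⟨z₁, hz₁, _, ⟨u, hu, rfl⟩, rfl⟩ := Submodule.mem_sup.mp hz
        have e : m u * v = m v * u := by simp only [m, LinearMap.mulLeft_apply]; ring
        have e1 : τ (m v) = τ a * τ v := hXY a ha v hv.1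
        have e2 : τ (m u) = τ a * τ u := hXY a ha u hu
        rw [add_mul, map_add, map_add, e, hXY _ hz₁ _ hv.1, hXY _ hv.2 _ hu, e1, e2]
        ring) rfl
    have := Submodule.finrank_mono hprod
    omega

end ScherkKemperman

section AlternatingValues

variable {ι W : Type*} [AddCommGroup W] [Module ℂ W]

lemma alternatingValues_mono {V V' : Submodule ℂ (ι → W)} (h : V' ≤ V) :
    alternatingValues V' ≤ alternatingValues V :=
  Submodule.span_mono fun _ ⟨i, α, v, hv, hf⟩ => ⟨i, α, v, fun l => h (hv l), hf⟩

lemma one_mem_alternatingValues (V : Submodule ℂ (ι → W)) : 1 ∈ alternatingValues V :=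
  Submodule.subset_span
    ⟨0, AlternatingMap.constOfIsEmpty ℂ W (Fin 0) 1, Fin.elim0, fun l => l.elim0, rfl⟩

/-- Wedging with a linear form that vanishes on all but the first argument. -/
lemma exists_wedge_apply_cons (φ : W →ₗ[ℂ] ℂ) {i : ℕ} (α : W [⋀^Fin i]→ₗ[ℂ] ℂ) :
    ∃ β : W [⋀^Fin (i + 1)]→ₗ[ℂ] ℂ, ∀ (w : W) (v : Fin i → W), (∀ l, φ (v l) = 0) →
      β (Fin.cons w v) = φ w * α v := by
  refine ⟨AlternatingMap.alternatizeUncurryFin (φ.smulRight α), fun w v hv => ?_⟩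
  rw [AlternatingMap.alternatizeUncurryFin_apply, Fin.sum_univ_succ]
  simp [hv]

lemma mem_ker_compLeft_iff (φ : W →ₗ[ℂ] ℂ) (v : ι → W) :
    v ∈ LinearMap.ker (φ.compLeft ι) ↔ ∀ j, φ (v j) = 0 := by
  rw [LinearMap.mem_ker, funext_iff]
  rfl

lemma exists_cons_eq_mul (φ : W →ₗ[ℂ] ℂ) {V : Submodule ℂ (ι → W)} {w : ι → W} (hw : w ∈ V)
    {i : ℕ} (α : W [⋀^Fin i]→ₗ[ℂ] ℂ) {v : Fin i → ι → W}
    (hv : ∀ l, v l ∈ V ⊓ LinearMap.ker (φ.compLeft ι)) :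
    ∃ (β : W [⋀^Fin (i + 1)]→ₗ[ℂ] ℂ) (u : Fin (i + 1) → ι → W), (∀ l, u l ∈ V) ∧
      (φ.compLeft ι w * fun j => α fun l => v l j) = fun j => β fun l => u l j := by
  obtain ⟨β, hβ⟩ := exists_wedge_apply_cons φ α
  refine ⟨β, Fin.cons w v, Fin.cases hw fun l => (hv l).1, funext fun j => ?_⟩
  have e : (fun l => (Fin.cons w v : Fin (i + 1) → ι → W) l j) = Fin.cons (w j) fun l => v l j := by
    ext l
    cases l using Fin.cases <;> rfl
  rw [e, hβ _ _ fun l => (mem_ker_compLeft_iff φ _).mp (hv l).2 j]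
  rfl

lemma mul_mem_alternatingValues (φ : W →ₗ[ℂ] ℂ) {V : Submodule ℂ (ι → W)} {w : ι → W} (hw : w ∈ V)
    {q : ι → ℂ} (hq : q ∈ alternatingValues (V ⊓ LinearMap.ker (φ.compLeft ι))) :
    φ.compLeft ι w * q ∈ alternatingValues V := by
  suffices h : alternatingValues (V ⊓ LinearMap.ker (φ.compLeft ι)) ≤
      (alternatingValues V).comap (LinearMap.mulLeft ℂ (φ.compLeft ι w)) from h hq
  refine Submodule.span_le.mpr ?_
  rintro _ ⟨i, α, v, hv, rfl⟩
  obtain ⟨β, u, hu, e⟩ := exists_cons_eq_mul φ hw α hv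
  exact Submodule.subset_span ⟨i + 1, β, u, hu, e⟩

lemma map_mul_eq_zero_of_alternatingValues (τ : (ι → ℂ) →ₗ[ℂ] ℂ) (φ : W →ₗ[ℂ] ℂ)
    {V : Submodule ℂ (ι → W)}
    (hV : ∀ i, 1 ≤ i → ∀ (α : W [⋀^Fin i]→ₗ[ℂ] ℂ) (v : Fin i → ι → W), (∀ l, v l ∈ V) →
      τ (fun j => α fun l => v l j) = 0)
    {w : ι → W} (hw : w ∈ V) {q : ι → ℂ}
    (hq : q ∈ alternatingValues (V ⊓ LinearMap.ker (φ.compLeft ι))) :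
    τ (φ.compLeft ι w * q) = 0 := by
  suffices h : alternatingValues (V ⊓ LinearMap.ker (φ.compLeft ι)) ≤
      LinearMap.ker (τ ∘ₗ LinearMap.mulLeft ℂ (φ.compLeft ι w)) from h hq
  refine Submodule.span_le.mpr ?_
  rintro _ ⟨i, α, v, hv, rfl⟩
  obtain ⟨β, u, hu, e⟩ := exists_cons_eq_mul φ hw α hv
  simpa [e] using hV (i + 1) (Nat.le_add_left 1 i) β u hu

lemma finrank_add_one_le_finrank_alternatingValues [Fintype ι] [FiniteDimensional ℂ W]
    (τ : (ι → ℂ) →ₗ[ℂ] ℂ) (hτ1 : τ 1 = 1) (hτ : ∀ n, τ (star n * n) = 0 → n = 0)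
    (V : Submodule ℂ (ι → W))
    (hV : ∀ i, 1 ≤ i → ∀ (α : W [⋀^Fin i]→ₗ[ℂ] ℂ) (v : Fin i → ι → W), (∀ l, v l ∈ V) →
      τ (fun j => α fun l => v l j) = 0) :
    finrank ℂ V + 1 ≤ finrank ℂ (alternatingValues V) := by
  induction hd : finrank ℂ V using Nat.strong_induction_on generalizing V with
  | _ d ih =>
  subst hd
  have hone : (1 : ι → ℂ) ≠ 0 := fun h => by simp [h] at hτ1
  by_cases hbot : V = ⊥
  · have h := Submodule.finrank_mono
      ((Submodule.span_singleton_le_iff_mem _ _).mpr (one_mem_alternatingValues V))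
    rw [finrank_span_singleton hone] at h
    rwa [hbot, finrank_bot, zero_add, ← hbot]
  obtain ⟨w, hw, hw0⟩ := V.ne_bot_iff.mp hbot
  obtain ⟨j, hj⟩ := Function.ne_iff.mp hw0
  obtain ⟨φ, hφ⟩ := not_forall.mp ((forall_dual_apply_eq_zero_iff ℂ (w j)).not.mpr hj)
  set ψ := LinearMap.compLeft φ ι
  set V' := V ⊓ LinearMap.ker ψ
  have hlt : V' < V := lt_of_le_of_ne inf_le_left fun h => by
    rw [← h] at hw
    exact hφ ((mem_ker_compLeft_iff φ w).mp hw.2 j)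
  have h₁ := ih _ (Submodule.finrank_lt_finrank_of_lt hlt) V'
    (fun i hi α v hv => hV i hi α v fun l => (hv l).1) rfl
  have hzero : ∀ a ∈ V.map ψ, ∀ q ∈ alternatingValues V', τ (a * q) = 0 := by
    rintro _ ⟨u, hu, rfl⟩ q hq
    exact map_mul_eq_zero_of_alternatingValues τ φ hV hu hq
  have hzero' : ∀ a ∈ V.map ψ, τ a = 0 := fun a ha => by
    simpa using hzero a ha 1 (one_mem_alternatingValues V')
  have h₂ := finrank_add_finrank_le_finrank_mul_add_one τ hτ1 hτ
    (Submodule.span ℂ {1} ⊔ V.map ψ) (alternatingValues V')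
    (Submodule.mem_sup_left (Submodule.mem_span_singleton_self 1)) (one_mem_alternatingValues V')
    (by
      intro x hx y hy
      obtain ⟨_, hc, a, ha, rfl⟩ := Submodule.mem_sup.mp hx
      obtain ⟨c, rfl⟩ := Submodule.mem_span_singleton.mp hc
      simp [add_mul, hzero a ha y hy, hzero' a ha, hτ1])
  have hle : (Submodule.span ℂ {1} ⊔ V.map ψ) * alternatingValues V' ≤ alternatingValues V := by
    rw [Submodule.sup_mul, sup_le_iff, ← Submodule.one_eq_span, one_mul]
    refine ⟨alternatingValues_mono inf_le_left, Submodule.mul_le.mpr ?_⟩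
    rintro _ ⟨u, hu, rfl⟩ q hq
    exact mul_mem_alternatingValues φ hu hq
  have h₃ := Submodule.finrank_mono hle
  have hdisj : Submodule.span ℂ {1} ⊓ V.map ψ = ⊥ := by
    rw [eq_bot_iff]
    rintro _ ⟨hc, ha⟩
    obtain ⟨c, rfl⟩ := Submodule.mem_span_singleton.mp hc
    have := hzero' _ ha
    simp_all
  have h₄ := Submodule.finrank_sup_add_finrank_inf_eq (Submodule.span ℂ {1}) (V.map ψ)
  rw [hdisj, finrank_bot, finrank_span_singleton hone] at h₄
  have h₅ := (ψ.domRestrict V).finrank_range_add_finrank_ker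
  rw [LinearMap.range_domRestrict, LinearMap.ker_domRestrict] at h₅
  have h₆ : finrank ℂ ((LinearMap.ker ψ).comap V.subtype) = finrank ℂ V' := by
    rw [(Submodule.equivMapOfInjective V.subtype V.injective_subtype _).finrank_eq,
      Submodule.map_comap_subtype]
  rw [h₆] at h₅
  omega

end AlternatingValues


/-- Let `W` be a finite-dimensional complex vector space and `k ≥ 1` an integer.
Let `V ⊆ W^k` be a linear subspace such that for every `i ≥ 1`, every alternating
`i`-linear form `α` on `W`, and all vectors `v^1, …, v^i ∈ V`, one has
`∑_{j=1}^{k} α(pr_j v^1, …, pr_j v^i) = 0`.  Then `dim V ≤ k - 1`. -/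
theorem dim_le_of_alternating_condition
    (W : Type*) [AddCommGroup W] [Module ℂ W] [FiniteDimensional ℂ W]
    (k : ℕ) (hk : 1 ≤ k) (V : Submodule ℂ (Fin k → W))
    (hV : ∀ (i : ℕ), 1 ≤ i → ∀ (α : W [⋀^Fin i]→ₗ[ℂ] ℂ)
      (v : Fin i → (Fin k → W)), (∀ l, v l ∈ V) →
      ∑ j : Fin k, α (fun l => v l j) = 0) :
    Module.finrank ℂ V ≤ k - 1 := by
  have hk0 : (k : ℂ) ≠ 0 := by exact_mod_cast (by omega : k ≠ 0)
  let τ : (Fin k → ℂ) →ₗ[ℂ] ℂ := (k : ℂ)⁻¹ • ∑ j, LinearMap.proj j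
  have hτ (f : Fin k → ℂ) : τ f = (k : ℂ)⁻¹ * ∑ j, f j := by simp [τ]
  have h := finrank_add_one_le_finrank_alternatingValues τ (by simp [hτ, hk0])
    (fun n hn => by
      rw [hτ, mul_eq_zero, or_iff_right (inv_ne_zero hk0)] at hn
      open scoped ComplexOrder in
      exact dotProduct_star_self_eq_zero.mp (by simpa [dotProduct, mul_comm] using hn))
    V (fun i hi α v hv => by rw [hτ, hV i hi α v hv, mul_zero])
  have h' := Submodule.finrank_le (alternatingValues V)
  rw [finrank_fin_fun] at h'
  omega
end

section
/- Let k ≥ 1 be an integer and let A, B be linear subspaces of ℂ^k such that: (i) for all a ∈ A and b ∈ B, ∑_{j=1}^{k} a_j b_j = 0; and (ii) for all a ∈ A, ∑_{j=1}^{k} a_j = 0, and for all b ∈ B, ∑_{j=1}^{k} b_j = 0. Let A·B denote the linear subspace of ℂ^k spanned by all coordinatewise products (a_1 b_1, …, a_k b_k) with a ∈ A, b ∈ B. Then dim(A·B + A + B) ≥ dim A + dim B. -/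
/-- A vector orthogonal to the dot-orthogonal complement of `A` lies in `A`. -/
theorem Submodule.mem_of_forall_dotProduct_eq_zero {F ι : Type*} [Field F] [Fintype ι]
    (A : Submodule F (ι → F)) (v : ι → F)
    (h : ∀ d : ι → F, (∀ a ∈ A, ∑ j, d j * a j = 0) → ∑ j, d j * v j = 0) : v ∈ A := by
  classical
  by_contra hv
  obtain ⟨f, hf, hA⟩ := Submodule.exists_le_ker_of_notMem hv
  have key : ∀ u : ι → F, f u = ∑ j, f (Pi.single j 1) * u j := fun u => by
    rw [f.pi_apply_eq_sum_univ u]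
    exact Finset.sum_congr rfl fun j _ => by
      rw [smul_eq_mul, mul_comm]; congr 2; ext i; simp [Pi.single_apply, eq_comm]
  exact hf ((key v).trans (h _ fun a ha => (key a).symm.trans (hA ha)))

/-- A sum `∑ ρ_j g_j` over an extension field vanishes as soon as `∑ f(ρ_j) g_j` does for every
linear functional `f`. -/
theorem sum_mul_eq_zero_of_forall_dual {F κ ι : Type*} [Field F] [Field κ] [Algebra F κ]
    [Fintype ι] (ρ g : ι → κ)
    (h : ∀ f : κ →ₗ[F] F, ∑ j, algebraMap F κ (f (ρ j)) * g j = 0) : ∑ j, ρ j * g j = 0 := by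
  classical
  let b := Module.Basis.ofVectorSpace F κ
  let T := Finset.univ.biUnion fun j => (b.repr (ρ j)).support
  have hρ : ∀ j, ρ j = ∑ i ∈ T, algebraMap F κ (b.coord i (ρ j)) * b i := fun j => by
    conv_lhs => rw [← b.linearCombination_repr (ρ j), Finsupp.linearCombination_apply]
    rw [Finsupp.sum_of_support_subset _ (Finset.subset_biUnion_of_mem
      (fun j => (b.repr (ρ j)).support) (Finset.mem_univ j)) _ (by simp)]
    exact Finset.sum_congr rfl fun i _ => by rw [Algebra.smul_def, b.coord_apply]
  calc ∑ j, ρ j * g j = ∑ j, ∑ i ∈ T, b i * (algebraMap F κ (b.coord i (ρ j)) * g j) := by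
        refine Finset.sum_congr rfl fun j _ => ?_
        conv_lhs => rw [hρ j, Finset.sum_mul]
        exact Finset.sum_congr rfl fun i _ => by ring
    _ = 0 := by
        rw [Finset.sum_comm]
        exact Finset.sum_eq_zero fun i _ => by rw [← Finset.mul_sum, h, mul_zero]

/-- An element which is not algebraic over `F[s]` is avoided by some valuation ring containing the
field `F(s)`. -/
theorem exists_valuationSubring_of_not_isAlgebraic {F L : Type*} [Field F] [Field L] [Algebra F L]
    (s : Set L) (z : L) (hz : ¬ IsAlgebraic (Algebra.adjoin F s) z) :
    ∃ O : ValuationSubring L, (IntermediateField.adjoin F s : Set L) ⊆ O ∧ z ∉ O := by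
  by_contra! H
  have hmem : z ∈ ⨅ V : {V : ValuationSubring L //
      (IntermediateField.adjoin F s : Set L) ⊆ V.toSubring}, V.1.toSubring := by
    rw [Subring.mem_iInf]
    exact fun V => H V.1 V.2
  rw [iInf_valuationSubring_superset] at hmem
  have hint : IsIntegral (Subring.closure (IntermediateField.adjoin F s : Set L)) z := hmem
  have hcl : Subring.closure (IntermediateField.adjoin F s : Set L)
      = (IntermediateField.adjoin F s).toSubring :=
    Subring.closure_eq (IntermediateField.adjoin F s).toSubring
  rw [hcl] at hint
  have h2 : IsIntegral (IntermediateField.adjoin F s) z := hint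
  exact hz (by
    have := h2.isAlgebraic
    exact IntermediateField.isAlgebraic_adjoin_iff.mp this)

/-- Let `x` lie in `1 + A_L` with `w / x` orthogonal to `A`. If all nonempty partial sums of `w` are
units of a valuation ring `O` containing the constants, then the coordinates of `x` lie in `O`. -/
theorem mem_valuationSubring_of_orthogonal {F L ι : Type*} [Field F] [Field L] [Algebra F L]
    [Fintype ι] (A : Submodule F (ι → F)) (O : ValuationSubring L)
    (hF : ∀ c : F, algebraMap F L c ∈ O) (w x : ι → L) (hw : ∀ j, w j ∈ O)
    (hwS : ∀ S : Finset ι, S.Nonempty → ∑ j ∈ S, w j ≠ 0 ∧ (∑ j ∈ S, w j)⁻¹ ∈ O)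
    (hx : ∀ d : ι → F, (∀ a ∈ A, ∑ j, d j * a j = 0) →
      ∑ j, algebraMap F L (d j) * x j = algebraMap F L (∑ j, d j))
    (hx0 : ∀ j, x j ≠ 0)
    (hwx : ∀ a ∈ A, ∑ j, algebraMap F L (a j) * (w j / x j) = 0) (j : ι) : x j ∈ O := by
  classical
  by_contra hj
  obtain ⟨m, -, hm⟩ := Finset.exists_max_image Finset.univ (fun j => O.valuation (x j))
    ⟨j, Finset.mem_univ j⟩
  have hm1 : 1 < O.valuation (x m) :=
    (not_le.mp fun h => hj ((O.valuation_le_one_iff _).mp h)).trans_le (hm j (Finset.mem_univ j))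
  have hr : ∀ i, x i / x m ∈ O := fun i => by
    rw [← O.valuation_le_one_iff, map_div₀]
    exact div_le_one_of_le₀ (hm i (Finset.mem_univ i)) zero_le
  have hinv : O.valuation (x m)⁻¹ < 1 := by
    rw [map_inv₀]; exact inv_lt_one_of_one_lt₀ hm1
  let φ : F →+* O := (algebraMap F L).codRestrict O.toSubring hF
  let π : O →+* IsLocalRing.ResidueField O := IsLocalRing.residue O
  let : Algebra F (IsLocalRing.ResidueField O) := (π.comp φ).toAlgebra
  have hφ : ∀ c, algebraMap F (IsLocalRing.ResidueField O) c = π (φ c) := fun c => rfl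
  have hφc : ∀ c, ((φ c : O) : L) = algebraMap F L c := fun c => rfl
  let r : ι → O := fun i => ⟨x i / x m, hr i⟩
  let W : ι → O := fun i => ⟨w i, hw i⟩
  let e : O := ⟨(x m)⁻¹, (O.valuation_le_one_iff _).mp hinv.le⟩
  have he : π e = 0 := by
    rw [IsLocalRing.residue_eq_zero_iff, O.valuation_lt_one_iff]; exact hinv
  have hrm : r m = 1 := Subtype.ext (div_self (hx0 m))
  have hfA : ∀ f : IsLocalRing.ResidueField O →ₗ[F] F, (fun i => f (π (r i))) ∈ A := fun f => by
    refine A.mem_of_forall_dotProduct_eq_zero _ fun d hd => ?_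
    have h1 : ∑ i, φ (d i) * r i = φ (∑ i, d i) * e := by
      apply Subtype.ext
      push_cast
      simp only [hφc, r, e]
      rw [← hx d hd, Finset.sum_mul]
      exact Finset.sum_congr rfl fun i _ => by rw [div_eq_mul_inv, mul_assoc]
    have h2 : ∑ i, d i • π (r i) = 0 := by
      have := congrArg π h1
      rw [map_sum, map_mul, he, mul_zero] at this
      simpa only [Algebra.smul_def, hφ, map_mul] using this
    simpa using congrArg f h2
  let S := Finset.univ.filter fun i => π (r i) ≠ 0
  have hmS : m ∈ S := by simp [S, hrm]
  have hrinv : ∀ i ∈ S, (x i / x m)⁻¹ ∈ O := fun i hi => by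
    have hu : IsUnit (r i) := by
      by_contra hn
      exact (Finset.mem_filter.mp hi).2 ((IsLocalRing.residue_eq_zero_iff _).mpr hn)
    rw [← O.valuation_le_one_iff, map_inv₀, (O.valuation_eq_one_iff (r i)).mp hu, inv_one]
  let q : ι → O := fun i => if hi : i ∈ S then ⟨(x i / x m)⁻¹, hrinv i hi⟩ else 0
  have hqr : ∀ i ∈ S, r i * q i = 1 := fun i hi => by
    apply Subtype.ext
    simp only [q, dif_pos hi, r]
    exact mul_inv_cancel₀ (div_ne_zero (hx0 i) (hx0 m))
  have hsum : ∑ i, π (r i) * π (q i * W i) = 0 := by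
    refine sum_mul_eq_zero_of_forall_dual (F := F) _ _ fun f => ?_
    have h1 : ∑ i, φ (f (π (r i))) * (q i * W i) = 0 := by
      apply Subtype.ext
      push_cast
      have h2 := congrArg (· * x m) (hwx _ (hfA f))
      simp only [zero_mul, Finset.sum_mul] at h2
      refine Eq.trans (Finset.sum_congr rfl fun i _ => ?_) h2
      rw [hφc]
      by_cases hi : i ∈ S
      · simp only [q, dif_pos hi, W]
        have := hx0 i
        have := hx0 m
        field_simp
      · have : π (r i) = 0 := by simpa [S] using hi
        simp [this]
    have := congrArg π h1
    simpa only [hφ, map_sum, map_mul, map_zero] using this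
  have hS : π (∑ i ∈ S, W i) = 0 := by
    rw [← hsum, map_sum, ← Finset.sum_filter_add_sum_filter_not Finset.univ (fun i => π (r i) ≠ 0)
      (fun i => π (r i) * π (q i * W i))]
    rw [Finset.sum_eq_zero (s := Finset.univ.filter fun i => ¬ π (r i) ≠ 0) fun i hi => ?_,
      add_zero]
    · refine Finset.sum_congr rfl fun i hi => ?_
      rw [← map_mul, ← mul_assoc, hqr i hi, one_mul]
    · simp [show π (r i) = 0 by simpa using hi]
  obtain ⟨h0, h1⟩ := hwS S ⟨m, hmS⟩
  have hone : (∑ i ∈ S, W i) * ⟨_, h1⟩ = 1 := by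
    apply Subtype.ext
    push_cast
    exact mul_inv_cancel₀ h0
  have := congrArg π hone
  rw [map_mul, hS, zero_mul, map_one] at this
  exact zero_ne_one this

/-- If `p` is orthogonal to `U`, then pairing `p` with a vector of `1 + U_L` gives `∑ p_j`. -/
theorem sum_mul_one_add_eq {F L ι τ : Type*} [Field F] [Field L] [Algebra F L] [Fintype ι]
    [Fintype τ] {U : Submodule F (ι → F)} (t : τ → L) (e : τ → U) (p : ι → L)
    (h : ∀ u ∈ U, ∑ j, p j * algebraMap F L (u j) = 0) :
    ∑ j, p j * (1 + ∑ i, t i * algebraMap F L ((e i : ι → F) j)) = ∑ j, p j := by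
  simp only [mul_add, mul_one, Finset.sum_add_distrib, add_eq_left, Finset.mul_sum]
  rw [Finset.sum_comm]
  refine Finset.sum_eq_zero fun i _ => ?_
  calc ∑ j, p j * (t i * algebraMap F L ((e i : ι → F) j))
      = t i * ∑ j, p j * algebraMap F L ((e i : ι → F) j) := by
        rw [Finset.mul_sum]; exact Finset.sum_congr rfl fun j _ => by ring
    _ = 0 := by rw [h _ (e i).2, mul_zero]

/-- If the coordinates of `1 + ∑ t_i e_i` lie in `O`, for a basis `e` of `U`, then so do the `t_i`. -/
theorem mem_valuationSubring_of_forall_one_add_mem {F L ι τ : Type*} [Field F] [Field L]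
    [Algebra F L] [Fintype ι] [Fintype τ] {U : Submodule F (ι → F)} (O : ValuationSubring L)
    (hF : ∀ c : F, algebraMap F L c ∈ O) (t : τ → L) (e : Module.Basis τ F U)
    (h : ∀ j, 1 + ∑ i, t i * algebraMap F L ((e i : ι → F) j) ∈ O) (i : τ) : t i ∈ O := by
  classical
  obtain ⟨g, hg⟩ := LinearMap.exists_extend (e.coord i)
  have hgi : ∀ l, ∑ j, ((e l : ι → F) j) * g (Pi.single j 1) = if l = i then 1 else 0 := fun l => by
    have h1 : g (e l) = e.coord i (e l) := LinearMap.congr_fun hg (e l)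
    rw [e.coord_apply, e.repr_self, Finsupp.single_apply] at h1
    rw [← h1, g.pi_apply_eq_sum_univ (e l : ι → F)]
    exact Finset.sum_congr rfl fun j _ => by
      rw [smul_eq_mul]; congr 2; ext i; simp [Pi.single_apply, eq_comm]
  have key : t i = ∑ j, ((1 + ∑ l, t l * algebraMap F L ((e l : ι → F) j)) - 1)
      * algebraMap F L (g (Pi.single j 1)) := by
    simp only [add_sub_cancel_left, Finset.sum_mul]
    rw [Finset.sum_comm]
    have : ∀ l, ∑ j, t l * algebraMap F L ((e l : ι → F) j) * algebraMap F L (g (Pi.single j 1))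
        = t l * if l = i then 1 else 0 := fun l => by
      have := congrArg (fun c => t l * algebraMap F L c) (hgi l)
      simp only [map_sum, map_mul, Finset.mul_sum] at this
      simpa [mul_assoc] using this
    simp [this]
  rw [key]
  exact sum_mem fun j _ => O.mul_mem _ _ (sub_mem (h j) O.one_mem) (hF _)

/-- A rational function field is algebraic over `F[s]` if its variables are. -/
theorem isAlgebraic_of_forall_X {F σ : Type*} [Field F]
    (s : Set (FractionRing (MvPolynomial σ F)))
    (h : ∀ i, IsAlgebraic (Algebra.adjoin F s)
      (algebraMap (MvPolynomial σ F) (FractionRing (MvPolynomial σ F)) (MvPolynomial.X i))) :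
    Algebra.IsAlgebraic (Algebra.adjoin F s) (FractionRing (MvPolynomial σ F)) := by
  have hp : ∀ p : MvPolynomial σ F, IsAlgebraic (Algebra.adjoin F s)
      (algebraMap (MvPolynomial σ F) (FractionRing (MvPolynomial σ F)) p) := fun p => by
    induction p using MvPolynomial.induction_on with
    | C a =>
      have : algebraMap (MvPolynomial σ F) (FractionRing (MvPolynomial σ F)) (MvPolynomial.C a)
          = algebraMap (Algebra.adjoin F s) _ (algebraMap F _ a) := by
        rw [← IsScalarTower.algebraMap_apply, ← MvPolynomial.algebraMap_eq,
          ← IsScalarTower.algebraMap_apply]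
      rw [this]
      exact isAlgebraic_algebraMap _
    | add p q hp hq => rw [map_add]; exact hp.add hq
    | mul_X p i hp => rw [map_mul]; exact hp.mul (h i)
  refine ⟨fun z => ?_⟩
  obtain ⟨a, b, -, rfl⟩ := IsFractionRing.div_surjective (A := MvPolynomial σ F) z
  rw [div_eq_mul_inv]
  exact (hp a).mul (hp b).inv

/-- Three subspaces of `F^ι`, in characteristic zero, such that all coordinatewise products of
elements of one, two or three different ones among them have zero sum, have total dimension less
than `|ι|`. -/
theorem finrank_add_finrank_add_finrank_lt {F ι : Type*} [Field F] [CharZero F] [Fintype ι]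
    [Nonempty ι] (A B C : Submodule F (ι → F))
    (hA : ∀ a ∈ A, ∑ j, a j = 0) (hB : ∀ b ∈ B, ∑ j, b j = 0) (hC : ∀ c ∈ C, ∑ j, c j = 0)
    (hAB : ∀ a ∈ A, ∀ b ∈ B, ∑ j, a j * b j = 0) (hAC : ∀ a ∈ A, ∀ c ∈ C, ∑ j, a j * c j = 0)
    (hBC : ∀ b ∈ B, ∀ c ∈ C, ∑ j, b j * c j = 0)
    (hABC : ∀ a ∈ A, ∀ b ∈ B, ∀ c ∈ C, ∑ j, a j * b j * c j = 0) :
    Module.finrank F A + Module.finrank F B + Module.finrank F C < Fintype.card ι := by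
  classical
  let σ := (Fin (Module.finrank F A) ⊕ Fin (Module.finrank F B)) ⊕ Fin (Module.finrank F C)
  let P := MvPolynomial σ F
  let L := FractionRing P
  let eA := Module.finBasis F A
  let eB := Module.finBasis F B
  let eC := Module.finBasis F C
  let T : σ → L := fun i => algebraMap P L (MvPolynomial.X i)
  let x : ι → L := fun j => 1 + ∑ i, T (.inl (.inl i)) * algebraMap F L ((eA i : ι → F) j)
  let y : ι → L := fun j => 1 + ∑ i, T (.inl (.inr i)) * algebraMap F L ((eB i : ι → F) j)
  let z : ι → L := fun j => 1 + ∑ i, T (.inr i) * algebraMap F L ((eC i : ι → F) j)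
  let w : ι → L := fun j => x j * y j * z j
  have hpoly : ∃ X Y Z : ι → P, (∀ j, algebraMap P L (X j) = x j ∧ algebraMap P L (Y j) = y j ∧
      algebraMap P L (Z j) = z j) ∧ ∀ j, MvPolynomial.constantCoeff (X j) = 1 ∧
      MvPolynomial.constantCoeff (Y j) = 1 ∧ MvPolynomial.constantCoeff (Z j) = 1 := by
    refine ⟨fun j => 1 + ∑ i, MvPolynomial.X (.inl (.inl i)) * algebraMap F P ((eA i : ι → F) j),
      fun j => 1 + ∑ i, MvPolynomial.X (.inl (.inr i)) * algebraMap F P ((eB i : ι → F) j),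
      fun j => 1 + ∑ i, MvPolynomial.X (.inr i) * algebraMap F P ((eC i : ι → F) j),
      fun j => ?_, fun j => ?_⟩
    · simp only [map_add, map_one, map_sum, map_mul, ← IsScalarTower.algebraMap_apply F P L]
      exact ⟨rfl, rfl, rfl⟩
    · simp
  obtain ⟨X, Y, Z, hXYZ, hcc⟩ := hpoly
  have hne : ∀ p : P, MvPolynomial.constantCoeff p ≠ 0 → algebraMap P L p ≠ 0 := fun p hp h0 => by
    rw [(IsFractionRing.injective P L).eq_iff' (map_zero _)] at h0
    exact hp (by rw [h0, map_zero])
  have hx0 : ∀ j, x j ≠ 0 := fun j => by rw [← (hXYZ j).1]; exact hne _ (by simp [hcc])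
  have hy0 : ∀ j, y j ≠ 0 := fun j => by rw [← (hXYZ j).2.1]; exact hne _ (by simp [hcc])
  have hz0 : ∀ j, z j ≠ 0 := fun j => by rw [← (hXYZ j).2.2]; exact hne _ (by simp [hcc])
  have hS0 : ∀ S : Finset ι, S.Nonempty → ∑ j ∈ S, w j ≠ 0 := fun S hS => by
    have : ∑ j ∈ S, w j = algebraMap P L (∑ j ∈ S, X j * Y j * Z j) := by
      rw [map_sum]
      exact Finset.sum_congr rfl fun j _ => by
        rw [map_mul, map_mul, (hXYZ j).1, (hXYZ j).2.1, (hXYZ j).2.2]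
    rw [this]
    apply hne
    simp [hcc, hS.ne_empty]
  have sX : ∀ p : ι → L, (∀ u ∈ A, ∑ j, p j * algebraMap F L (u j) = 0) →
      ∑ j, p j * x j = ∑ j, p j := fun p => sum_mul_one_add_eq _ eA p
  have sY : ∀ p : ι → L, (∀ u ∈ B, ∑ j, p j * algebraMap F L (u j) = 0) →
      ∑ j, p j * y j = ∑ j, p j := fun p => sum_mul_one_add_eq _ eB p
  have sZ : ∀ p : ι → L, (∀ u ∈ C, ∑ j, p j * algebraMap F L (u j) = 0) →
      ∑ j, p j * z j = ∑ j, p j := fun p => sum_mul_one_add_eq _ eC p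
  have base : ∀ p : ι → F, ∑ j, p j = 0 → ∑ j, algebraMap F L (p j) = 0 := fun p hp => by
    rw [← map_sum, hp, map_zero]
  have cA : ∀ a ∈ A, ∑ j, algebraMap F L (a j) = 0 := fun a ha => base _ (hA a ha)
  have cB : ∀ a ∈ B, ∑ j, algebraMap F L (a j) = 0 := fun a ha => base _ (hB a ha)
  have cC : ∀ a ∈ C, ∑ j, algebraMap F L (a j) = 0 := fun a ha => base _ (hC a ha)
  have cAB : ∀ a ∈ A, ∀ b ∈ B, ∑ j, algebraMap F L (a j) * algebraMap F L (b j) = 0 :=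
    fun a ha b hb => by simpa using base _ (hAB a ha b hb)
  have cAC : ∀ a ∈ A, ∀ b ∈ C, ∑ j, algebraMap F L (a j) * algebraMap F L (b j) = 0 :=
    fun a ha b hb => by simpa using base _ (hAC a ha b hb)
  have cBC : ∀ a ∈ B, ∀ b ∈ C, ∑ j, algebraMap F L (a j) * algebraMap F L (b j) = 0 :=
    fun a ha b hb => by simpa using base _ (hBC a ha b hb)
  have cABC : ∀ a ∈ A, ∀ b ∈ B, ∀ c ∈ C,
      ∑ j, algebraMap F L (a j) * algebraMap F L (b j) * algebraMap F L (c j) = 0 :=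
    fun a ha b hb c hc => by simpa using base _ (hABC a ha b hb c hc)
  have oA : ∀ a ∈ A, ∑ j, algebraMap F L (a j) * y j * z j = 0 := fun a ha => by
    rw [sZ, sY _ (cAB a ha), cA a ha]
    intro c hc
    simp only [mul_right_comm _ (y _)]
    rw [sY, cAC a ha c hc]
    intro b hb
    simpa only [mul_right_comm _ _ (algebraMap F L (b _))] using cABC a ha b hb c hc
  have oB : ∀ b ∈ B, ∑ j, algebraMap F L (b j) * x j * z j = 0 := fun b hb => by
    rw [sZ, sX _ fun a ha => by simpa only [mul_comm] using cAB a ha b hb, cB b hb]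
    intro c hc
    simp only [mul_right_comm _ (x _)]
    rw [sX, cBC b hb c hc]
    intro a ha
    rw [← cABC a ha b hb c hc]
    exact Finset.sum_congr rfl fun j _ => by ring
  have oC : ∀ c ∈ C, ∑ j, algebraMap F L (c j) * x j * y j = 0 := fun c hc => by
    rw [sY, sX _ fun a ha => by simpa only [mul_comm] using cAC a ha c hc, cC c hc]
    intro b hb
    simp only [mul_right_comm _ (x _)]
    rw [sX]
    · simpa only [mul_comm] using cBC b hb c hc
    intro a ha
    rw [← cABC a ha b hb c hc]
    exact Finset.sum_congr rfl fun j _ => by ring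
  have hsum : ∑ j, w j = Fintype.card ι := by
    have h1 : ∑ j, x j * y j = Fintype.card ι := by
      rw [sY _ fun b hb => ?_]
      · simpa using sX (fun _ => 1) (by simpa using cA)
      · simp only [mul_comm (x _)]
        rw [sX _ fun a ha => by simpa only [mul_comm] using cAB a ha b hb, cB b hb]
    rw [← h1]
    refine sZ _ fun c hc => ?_
    rw [← oC c hc]
    exact Finset.sum_congr rfl fun j _ => by ring
  obtain ⟨m⟩ := ‹Nonempty ι›
  let s : Set L := ((Finset.univ.erase m).image w : Finset L)
  have hwm : ∀ j, w j ∈ IntermediateField.adjoin F s := fun j => by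
    have h1 : ∀ i, i ≠ m → w i ∈ IntermediateField.adjoin F s := fun i hi =>
      IntermediateField.subset_adjoin _ _ (by
        simp only [s, Finset.mem_coe]
        exact Finset.mem_image_of_mem _ (by simp [hi]))
    by_cases hj : j = m
    · subst hj
      have : w j = (Fintype.card ι : L) - ∑ i ∈ Finset.univ.erase j, w i := by
        rw [← hsum, ← Finset.add_sum_erase _ _ (Finset.mem_univ j), add_sub_cancel_right]
      rw [this]
      exact sub_mem (natCast_mem _ _) (sum_mem fun i hi => h1 i (Finset.ne_of_mem_erase hi))
    · exact h1 j hj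
  have halg : ∀ i, IsAlgebraic (Algebra.adjoin F s) (T i) := fun i => by
    by_contra hi
    obtain ⟨O, hO, hiO⟩ := exists_valuationSubring_of_not_isAlgebraic s (T i) hi
    have hF : ∀ c : F, algebraMap F L c ∈ O := fun c =>
      hO ((IntermediateField.adjoin F s).algebraMap_mem c)
    have hwO : ∀ j, w j ∈ O := fun j => hO (hwm j)
    have hwS : ∀ S : Finset ι, S.Nonempty → ∑ j ∈ S, w j ≠ 0 ∧ (∑ j ∈ S, w j)⁻¹ ∈ O :=
      fun S hS => ⟨hS0 S hS, hO (inv_mem (sum_mem fun j _ => hwm j))⟩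
    have dual : ∀ d a : ι → F, ∑ j, d j * a j = 0 →
        ∑ j, algebraMap F L (d j) * algebraMap F L (a j) = 0 := fun d a h => by
      simpa using base _ h
    have hxO := mem_valuationSubring_of_orthogonal A O hF w x hwO hwS
      (fun d hd => by rw [map_sum]; exact sX _ fun u hu => dual _ _ (hd u hu)) hx0
      (fun a ha => by
        rw [← oA a ha]
        exact Finset.sum_congr rfl fun j _ => by
          rw [show w j = x j * (y j * z j) by simp only [w]; ring, mul_div_cancel_left₀ _ (hx0 j),
            mul_assoc])
    have hyO := mem_valuationSubring_of_orthogonal B O hF w y hwO hwS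
      (fun d hd => by rw [map_sum]; exact sY _ fun u hu => dual _ _ (hd u hu)) hy0
      (fun a ha => by
        rw [← oB a ha]
        exact Finset.sum_congr rfl fun j _ => by
          rw [show w j = y j * (x j * z j) by simp only [w]; ring, mul_div_cancel_left₀ _ (hy0 j),
            mul_assoc])
    have hzO := mem_valuationSubring_of_orthogonal C O hF w z hwO hwS
      (fun d hd => by rw [map_sum]; exact sZ _ fun u hu => dual _ _ (hd u hu)) hz0
      (fun a ha => by
        rw [← oC a ha]
        exact Finset.sum_congr rfl fun j _ => by
          rw [show w j = z j * (x j * y j) by simp only [w]; ring, mul_div_cancel_left₀ _ (hz0 j),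
            mul_assoc])
    apply hiO
    obtain (i | i) | i := i
    · exact mem_valuationSubring_of_forall_one_add_mem O hF _ eA hxO i
    · exact mem_valuationSubring_of_forall_one_add_mem O hF _ eB hyO i
    · exact mem_valuationSubring_of_forall_one_add_mem O hF _ eC hzO i
  have := isAlgebraic_of_forall_X s halg
  have h1 : Algebra.trdeg F L ≤ Cardinal.mk s := Algebra.IsAlgebraic.trdeg_le_cardinalMk F s
  have hT : AlgebraicIndependent F T :=
    (MvPolynomial.algebraicIndependent_X σ F).map' (f := IsScalarTower.toAlgHom F P L)
      (IsFractionRing.injective P L)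
  have h2 := hT.lift_cardinalMk_le_trdeg.trans (Cardinal.lift_le.mpr h1)
  have h3 : Fintype.card σ ≤ ((Finset.univ.erase m).image w).card := by
    rw [show Cardinal.mk s = _ from Cardinal.mk_coe_finset] at h2
    simpa only [Cardinal.mk_fintype, Cardinal.lift_natCast, Nat.cast_le] using h2
  have h4 : ((Finset.univ.erase m).image w).card ≤ Fintype.card ι - 1 := by
    simpa using Finset.card_image_le (s := Finset.univ.erase m) (f := w)
  have h5 : Fintype.card σ
      = Module.finrank F A + Module.finrank F B + Module.finrank F C := by simp [σ]
  have : 0 < Fintype.card ι := Fintype.card_pos_iff.mpr ⟨m⟩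
  omega

/-- Let `k ≥ 1` and let `A, B ⊆ ℂ^k` be linear subspaces such that:
(i) `∑_j a_j b_j = 0` for all `a ∈ A`, `b ∈ B`; and
(ii) `∑_j a_j = 0` for all `a ∈ A` and `∑_j b_j = 0` for all `b ∈ B`.
Let `A·B` be the linear span of all coordinatewise products `(a_j b_j)_j` with `a ∈ A`,
`b ∈ B`.  Then `dim (A·B + A + B) ≥ dim A + dim B`. -/
theorem dim_product_span_ge
    (k : ℕ) (hk : 1 ≤ k) (A B : Submodule ℂ (Fin k → ℂ))
    (h1 : ∀ a ∈ A, ∀ b ∈ B, ∑ j : Fin k, a j * b j = 0)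
    (h2 : ∀ a ∈ A, ∑ j : Fin k, a j = 0)
    (h3 : ∀ b ∈ B, ∑ j : Fin k, b j = 0) :
    Module.finrank ℂ A + Module.finrank ℂ B ≤
      Module.finrank ℂ
        ↥(Submodule.span ℂ {v : Fin k → ℂ | ∃ a ∈ A, ∃ b ∈ B, v = fun j => a j * b j}
            ⊔ A ⊔ B) := by
  set W := Submodule.span ℂ {v : Fin k → ℂ | ∃ a ∈ A, ∃ b ∈ B, v = fun j => a j * b j} ⊔ A ⊔ B
  have : Nonempty (Fin k) := ⟨⟨0, hk⟩⟩
  let V := W ⊔ Submodule.span ℂ {(1 : Fin k → ℂ)}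
  let ψ := Module.piEquiv (Fin k) ℂ ℂ
  let C : Submodule ℂ (Fin k → ℂ) := V.dualAnnihilator.comap ψ.toLinearMap
  have hCV : ∀ c ∈ C, ∀ v ∈ V, ∑ j, v j * c j = 0 := fun c hc v hv => by
    have := (Submodule.mem_dualAnnihilator _).mp (Submodule.mem_comap.mp hc) v hv
    simpa [ψ, Module.piEquiv_apply_apply] using this
  have hdim : Module.finrank ℂ C + Module.finrank ℂ V = k := by
    have e : Module.finrank ℂ C = Module.finrank ℂ V.dualAnnihilator :=
      (ψ.ofSubmodule' V.dualAnnihilator).finrank_eq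
    have := Subspace.finrank_add_finrank_dualAnnihilator_eq V
    rw [e, add_comm, this]
    simp
  have hV : Module.finrank ℂ V ≤ Module.finrank ℂ W + 1 :=
    (Submodule.finrank_add_le_finrank_add_finrank _ _).trans
      (Nat.add_le_add_left ((finrank_span_le_card _).trans (by simp)) _)
  have hWV : W ≤ V := le_sup_left
  have hAV : A ≤ V := (le_sup_right.trans le_sup_left).trans hWV
  have hBV : B ≤ V := le_sup_right.trans hWV
  have hlt := finrank_add_finrank_add_finrank_lt A B C h2 h3
    (fun c hc => by
      simpa using hCV c hc 1 (Submodule.mem_sup_right (Submodule.mem_span_singleton_self _)))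
    h1 (fun a ha c hc => hCV c hc a (hAV ha)) (fun b hb c hc => hCV c hc b (hBV hb))
    (fun a ha b hb c hc => hCV c hc _ (hWV (Submodule.mem_sup_left (Submodule.mem_sup_left
      (Submodule.subset_span ⟨a, ha, b, hb, rfl⟩)))))
  rw [Fintype.card_fin] at hlt
  omega
end

section
/- Let k ≥ 1 be an integer, let e = (1, …, 1) ∈ ℂ^k, and let A, B be linear subspaces of ℂ^k such that: (i) for all a ∈ A and b ∈ B, ∑_{j=1}^{k} a_j b_j = 0; and (ii) for all a ∈ A, ∑_{j=1}^{k} a_j = 0, and for all b ∈ B, ∑_{j=1}^{k} b_j = 0. Consider the set S = { a ∈ ℂ^k : a − e ∈ A, a_j ≠ 0 for all j, and (a_1^{-1}, …, a_k^{-1}) − e ∈ B }. Then e is an isolated point of S (for the standard topology of ℂ^k): there is an open neighborhood U of e in ℂ^k with U ∩ S = {e}. -/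
/-- If a finite-type algebra `R` over an algebraically closed field `K` is an integral extension
of `P`, then every `K`-point of `P` lifts to `R`. -/
lemma AlgHom.exists_comp_eq_of_isIntegral {K R P : Type*} [Field K] [IsAlgClosed K]
    [CommRing R] [Algebra K R] [Algebra.FiniteType K R] [CommRing P] [Algebra K P]
    (g : P →ₐ[K] R) (hg : Function.Injective g) (hg_int : g.IsIntegral) (ψ : P →ₐ[K] K) :
    ∃ φ : R →ₐ[K] K, φ.comp g = ψ := by
  have hψ : Function.Surjective ψ := fun c => ⟨algebraMap K P c, by simp⟩
  have hM : (RingHom.ker ψ).IsMaximal := RingHom.ker_isMaximal_of_surjective ψ hψ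
  algebraize [g.toRingHom]
  obtain ⟨Q, hQ, hQM⟩ := Ideal.exists_ideal_over_maximal_of_isIntegral (S := R) (RingHom.ker ψ)
    (by
      intro x hx
      have : g x = 0 := hx
      rw [(map_eq_zero_iff g hg).1 this]
      exact zero_mem _)
  let : Field (R ⧸ Q) := Ideal.Quotient.field Q
  have : Module.Finite K (R ⧸ Q) := finite_of_finite_type_of_isJacobsonRing K (R ⧸ Q)
  let φ : R →ₐ[K] K := (IsAlgClosed.lift : (R ⧸ Q) →ₐ[K] K).comp (Ideal.Quotient.mkₐ K Q)
  refine ⟨φ, AlgHom.ext fun p => ?_⟩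
  have hmem : p - algebraMap K P (ψ p) ∈ RingHom.ker ψ := by simp [RingHom.mem_ker]
  rw [← hQM, Ideal.mem_comap] at hmem
  have h0 : φ (g (p - algebraMap K P (ψ p))) = 0 := by
    have : Ideal.Quotient.mkₐ K Q (g (p - algebraMap K P (ψ p))) = 0 :=
      Ideal.Quotient.eq_zero_iff_mem.2 hmem
    simp only [φ, AlgHom.comp_apply, this, map_zero]
  simpa [sub_eq_zero] using h0

open MvPolynomial in
/-- A bounded affine algebraic subset of complex affine space is finite. -/
lemma MvPolynomial.finite_zeroLocus_of_isBounded {σ : Type*} [Finite σ]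
    (J : Ideal (MvPolynomial σ ℂ)) (hb : Bornology.IsBounded (zeroLocus ℂ J)) :
    (zeroLocus ℂ J).Finite := by
  cases nonempty_fintype σ
  rcases eq_or_ne J ⊤ with rfl | hJ
  · refine Set.Finite.subset Set.finite_empty fun x hx => ?_
    simpa using hx 1 Submodule.mem_top
  have : Nontrivial (MvPolynomial σ ℂ ⧸ J) := Ideal.Quotient.nontrivial_iff.2 hJ
  obtain ⟨s, g, hg, hg_int⟩ := exists_integral_inj_algHom_of_fg ℂ (MvPolynomial σ ℂ ⧸ J)
  rcases s with _ | s
  · have hi : ∀ r : MvPolynomial σ ℂ ⧸ J, IsIntegral ℂ r := by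
      intro r
      have h0 : (algebraMap ℂ (MvPolynomial (Fin 0) ℂ)).IsIntegral :=
        RingHom.isIntegral_of_surjective _ (MvPolynomial.C_surjective (Fin 0))
      have := h0.trans _ _ hg_int r
      rwa [show g.toRingHom.comp (algebraMap ℂ _) = algebraMap ℂ _ from g.comp_algebraMap] at this
    choose p hpm hp using fun i : σ => hi (Ideal.Quotient.mk J (X i))
    refine (Set.Finite.pi' fun i : σ => (p i).rootSet_finite ℂ).subset fun x hx i => ?_
    let ev : (MvPolynomial σ ℂ ⧸ J) →ₐ[ℂ] ℂ := Ideal.Quotient.liftₐ J (aeval x) hx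
    have h1 : ev (Ideal.Quotient.mk J (X i)) = x i := aeval_X x i
    rw [Polynomial.mem_rootSet]
    refine ⟨(hpm i).ne_zero, ?_⟩
    rw [← h1, Polynomial.aeval_algHom_apply, Polynomial.aeval_def, hp, map_zero]
  · exfalso
    obtain ⟨q, hq⟩ := Ideal.Quotient.mk_surjective (g (X 0))
    have hcont : Continuous fun x : σ → ℂ => eval x q := MvPolynomial.continuous_eval q
    have hcomp : IsCompact (closure (zeroLocus ℂ J)) := hb.isCompact_closure
    obtain ⟨C, hC⟩ := hcomp.exists_bound_of_continuousOn hcont.continuousOn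
    obtain ⟨φ, hφ⟩ := AlgHom.exists_comp_eq_of_isIntegral g hg hg_int
      (aeval fun _ => ((|C| + 1 : ℝ) : ℂ))
    let x : σ → ℂ := fun i => φ (Ideal.Quotient.mk J (X i))
    have hev : ∀ r, aeval x r = φ (Ideal.Quotient.mk J r) := by
      intro r
      have : aeval x = φ.comp (Ideal.Quotient.mkₐ ℂ J) := by
        ext i
        simp [x]
      rw [this]
      rfl
    have hx : x ∈ zeroLocus ℂ J := fun r hr => by
      rw [hev, Ideal.Quotient.eq_zero_iff_mem.2 hr, map_zero]
    have h1 := hC x (subset_closure hx)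
    have h2 : eval x q = ((|C| + 1 : ℝ) : ℂ) := by
      rw [← aeval_eq_eval, hev, hq]
      simpa using DFunLike.congr_fun hφ (X 0)
    rw [h2, Complex.norm_real, Real.norm_of_nonneg (by positivity)] at h1
    linarith [le_abs_self C]

/-- If `A` is orthogonal to `B` and to `1`, then the points `a ∈ 1 + A` whose inverse lies in
`1 + B` form a bounded set. -/
lemma isBounded_multiplication_fiber {ι : Type*} [Fintype ι] (A B : Submodule ℂ (ι → ℂ))
    (hAB : ∀ a ∈ A, ∀ b ∈ B, ∑ j, a j * b j = 0) (hA : ∀ a ∈ A, ∑ j, a j = 0) :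
    Bornology.IsBounded {a : ι → ℂ | a - 1 ∈ A ∧ (∀ j, a j ≠ 0) ∧ a⁻¹ - 1 ∈ B} := by
  by_contra hb
  rw [isBounded_iff_forall_norm_le] at hb
  push Not at hb
  choose a ha hn using fun n : ℕ => hb (n + 1)
  have hpos : ∀ n, 0 < ‖a n‖ := fun n => lt_trans (by positivity) (hn n)
  let c : ℕ → ℂ := fun n => (‖a n‖ : ℂ)⁻¹
  have hc0 : ∀ n, c n ≠ 0 := fun n => inv_ne_zero (by exact_mod_cast (hpos n).ne')
  have hc : Filter.Tendsto c Filter.atTop (nhds 0) := by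
    rw [tendsto_zero_iff_norm_tendsto_zero]
    refine squeeze_zero (fun _ => norm_nonneg _) (fun n => ?_)
      tendsto_one_div_add_atTop_nhds_zero_nat
    simp only [c, norm_inv, Complex.norm_real, norm_norm, one_div]
    exact inv_anti₀ (by positivity) (hn n).le
  have hr : ∀ n, c n • a n ∈ Metric.sphere (0 : ι → ℂ) 1 := fun n => by
    simp [c, norm_smul, (hpos n).ne']
  obtain ⟨r, hr1, φ, hφ, hlim⟩ := (isCompact_sphere (0 : ι → ℂ) 1).tendsto_subseq hr
  have hcφ := hc.comp hφ.tendsto_atTop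
  have hrA : r ∈ A := by
    have hlim' : Filter.Tendsto (fun n => c (φ n) • (a (φ n) - 1)) Filter.atTop (nhds r) := by
      have := hlim.sub (hcφ.smul_const (1 : ι → ℂ))
      simpa [smul_sub] using this
    exact A.closed_of_finiteDimensional.mem_of_tendsto hlim'
      (Filter.Eventually.of_forall fun n => A.smul_mem _ (ha _).1)
  have hzero : ∀ n, ∑ j, r j * ((c (φ n) • a (φ n)) j)⁻¹ = 0 := by
    intro n
    have h1 := hAB r hrA _ (ha (φ n)).2.2
    simp only [Pi.sub_apply, Pi.inv_apply, Pi.one_apply, mul_sub, mul_one,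
      Finset.sum_sub_distrib, hA r hrA, sub_zero] at h1
    simp only [Pi.smul_apply, smul_eq_mul, mul_inv, mul_left_comm _ (c (φ n))⁻¹,
      ← Finset.mul_sum, h1, mul_zero]
  have hsum : Filter.Tendsto (fun n => ∑ j, r j * ((c (φ n) • a (φ n)) j)⁻¹) Filter.atTop
      (nhds (∑ j, r j * (r j)⁻¹)) := by
    refine tendsto_finsetSum _ fun j _ => ?_
    by_cases hj : r j = 0
    · simp [hj]
    · exact (((continuous_apply j).tendsto r).comp hlim |>.inv₀ hj).const_mul _
  simp only [hzero] at hsum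
  have hs := tendsto_nhds_unique hsum tendsto_const_nhds
  have hr0 : r ≠ 0 := by
    rintro rfl
    simp at hr1
  obtain ⟨i, hi⟩ := Function.ne_iff.1 hr0
  have hcard : ∑ j, r j * (r j)⁻¹ = ((Finset.univ.filter fun j => r j ≠ 0).card : ℂ) := by
    rw [Finset.card_filter]
    push_cast
    refine Finset.sum_congr rfl fun j _ => ?_
    by_cases hj : r j = 0 <;> simp [hj]
  rw [hcard] at hs
  have : (Finset.univ.filter fun j => r j ≠ 0).card = 0 := by exact_mod_cast hs
  rw [Finset.card_eq_zero] at this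
  exact Finset.notMem_empty i (this ▸ Finset.mem_filter.2 ⟨Finset.mem_univ i, hi⟩)

open MvPolynomial in
/-- The translate of a linear subspace by `1` is cut out by polynomials, here in the variables
selected by `f`. -/
lemma Submodule.exists_mvPolynomial_of_notMem {ι σ K : Type*} [Finite ι] [Field K]
    (A : Submodule K (ι → K)) (f : ι → σ) {x : ι → K} (hx : x - 1 ∉ A) :
    ∃ p : MvPolynomial σ K, (∀ z : σ → K, z ∘ f - 1 ∈ A → aeval z p = 0) ∧
      ∀ z : σ → K, z ∘ f = x → aeval z p ≠ 0 := by
  cases nonempty_fintype ι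
  classical
  obtain ⟨l, hl, hAl⟩ := Submodule.exists_le_ker_of_notMem hx
  have key : ∀ z : σ → K, aeval z (∑ i, (X (f i) - 1) * C (l fun j => if i = j then 1 else 0)) =
      l (z ∘ f - 1) := by
    intro z
    simp [LinearMap.pi_apply_eq_sum_univ l (z ∘ f - 1)]
  refine ⟨_, fun z hz => (key z).trans (hAl hz), fun z hz => ?_⟩
  rw [key, hz]
  exact hl

open MvPolynomial in
/-- If `A`, `B` and `1` are mutually orthogonal, then only finitely many points of `1 + A` have
their inverse in `1 + B`. -/
lemma finite_multiplication_fiber {ι : Type*} [Fintype ι] (A B : Submodule ℂ (ι → ℂ))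
    (hAB : ∀ a ∈ A, ∀ b ∈ B, ∑ j, a j * b j = 0) (hA : ∀ a ∈ A, ∑ j, a j = 0)
    (hB : ∀ b ∈ B, ∑ j, b j = 0) :
    {a : ι → ℂ | a - 1 ∈ A ∧ (∀ j, a j ≠ 0) ∧ a⁻¹ - 1 ∈ B}.Finite := by
  have hbA := isBounded_multiplication_fiber A B hAB hA
  have hbB := isBounded_multiplication_fiber B A
    (fun b hb a ha => by simpa only [mul_comm] using hAB a ha b hb) hB
  set S := {a : ι → ℂ | a - 1 ∈ A ∧ (∀ j, a j ≠ 0) ∧ a⁻¹ - 1 ∈ B}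
  let T : Set (ι ⊕ ι → ℂ) := (fun a => Sum.elim a a⁻¹) '' S
  have hT : zeroLocus ℂ (vanishingIdeal ℂ T) ⊆ T := by
    intro z hz
    have h1 : z ∘ Sum.inl - 1 ∈ A := by
      by_contra h
      obtain ⟨p, hp, hp'⟩ := A.exists_mvPolynomial_of_notMem (Sum.inl : ι → ι ⊕ ι) h
      refine hp' z rfl (hz p ?_)
      rintro _ ⟨a, ha, rfl⟩
      exact hp _ ha.1
    have h2 : z ∘ Sum.inr - 1 ∈ B := by
      by_contra h
      obtain ⟨p, hp, hp'⟩ := B.exists_mvPolynomial_of_notMem (Sum.inr : ι → ι ⊕ ι) h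
      refine hp' z rfl (hz p ?_)
      rintro _ ⟨a, ha, rfl⟩
      exact hp _ ha.2.2
    have h3 : ∀ j, z (Sum.inl j) * z (Sum.inr j) = 1 := by
      intro j
      have := hz (X (Sum.inl j) * X (Sum.inr j) - 1) (by
        rintro _ ⟨a, ha, rfl⟩
        simp [ha.2.1 j])
      simpa [sub_eq_zero] using this
    have h4 : (z ∘ Sum.inl)⁻¹ = z ∘ Sum.inr := funext fun j => inv_eq_of_mul_eq_one_right (h3 j)
    refine ⟨z ∘ Sum.inl, ⟨h1, fun j => left_ne_zero_of_mul_eq_one (h3 j), h4 ▸ h2⟩, ?_⟩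
    simp only [h4, Sum.elim_comp_inl_inr]
  have hTb : Bornology.IsBounded T := by
    rw [isBounded_iff_forall_norm_le] at hbA hbB ⊢
    obtain ⟨M, hM⟩ := hbA
    obtain ⟨N, hN⟩ := hbB
    refine ⟨max (max M N) 0, ?_⟩
    rintro _ ⟨a, ha, rfl⟩
    rw [pi_norm_le_iff_of_nonneg (le_max_right _ _)]
    have hM' := hM a ha
    have hN' := hN a⁻¹ ⟨ha.2.2, fun j => inv_ne_zero (ha.2.1 j), by simpa using ha.1⟩
    rintro (j | j)
    · exact (norm_le_pi_norm a j).trans (by simp [hM'])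
    · exact (norm_le_pi_norm a⁻¹ j).trans (by simp [hN'])
  have hfin := (finite_zeroLocus_of_isBounded _ (hTb.subset hT)).subset
    (zeroLocus_vanishingIdeal_le T)
  refine Set.Finite.of_finite_image hfin fun a _ b _ h => ?_
  simpa using congrArg (· ∘ Sum.inl) h

/-- Let `k ≥ 1`, `e = (1, …, 1) ∈ ℂ^k`, and let `A, B ⊆ ℂ^k` be linear subspaces with:
(i) `∑_j a_j b_j = 0` for all `a ∈ A`, `b ∈ B`; and
(ii) `∑_j a_j = 0` for all `a ∈ A` and `∑_j b_j = 0` for all `b ∈ B`.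
Let `S = { a : a - e ∈ A, all a_j ≠ 0, (a_j⁻¹)_j - e ∈ B }`.  Then `e` is an isolated
point of `S`: there is an open neighborhood `U` of `e` with `U ∩ S = {e}`. -/
theorem isolated_point_of_multiplication_fiber
    (k : ℕ) (hk : 1 ≤ k) (A B : Submodule ℂ (Fin k → ℂ))
    (h1 : ∀ a ∈ A, ∀ b ∈ B, ∑ j : Fin k, a j * b j = 0)
    (h2 : ∀ a ∈ A, ∑ j : Fin k, a j = 0)
    (h3 : ∀ b ∈ B, ∑ j : Fin k, b j = 0)
    (e : Fin k → ℂ) (he : e = fun _ => 1)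
    (S : Set (Fin k → ℂ))
    (hS : S = {a : Fin k → ℂ | a - e ∈ A ∧ (∀ j, a j ≠ 0) ∧
      (fun j => (a j)⁻¹) - e ∈ B}) :
    ∃ U : Set (Fin k → ℂ), IsOpen U ∧ e ∈ U ∧ U ∩ S = {e} := by
  subst he
  have hfin : S.Finite := hS ▸ finite_multiplication_fiber A B h1 h2 h3
  have heS : (fun _ => 1 : Fin k → ℂ) ∈ S := by
    rw [hS]
    refine ⟨by simp, by simp, ?_⟩
    convert B.zero_mem using 1
    ext
    simp
  refine ⟨(S \ {fun _ => 1})ᶜ, (hfin.sdiff).isClosed.isOpen_compl, by simp, ?_⟩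
  ext x
  simp only [Set.mem_inter_iff, Set.mem_compl_iff, Set.mem_sdiff, Set.mem_singleton_iff]
  constructor
  · rintro ⟨hx, hxS⟩
    by_contra h
    exact hx ⟨hxS, h⟩
  · rintro rfl
    exact ⟨fun h => h.2 rfl, heS⟩
end
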